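/- arXiv:2411.13285 — 2 statements merged into one kernel-verified Lean document; each statement's English description precedes it below -/
import Mathlib

section
/- Let λ ≥ √2 be a real number, and let x₁, y₁ be real numbers with |x₁| ≤ 1/λ and |y₁| ≤ 1/λ. Then (λ² − 1)·|x₁·y₁| + √(1 − x₁²)·√(1 − y₁²) ≤ 2 − 2/λ². -/
theorem stmt0 (lam x1 y1 : ℝ) (hlam : Real.sqrt 2 ≤ lam)
    (hx : |x1| ≤ 1 / lam) (hy : |y1| ≤ 1 / lam) :
    (lam ^ 2 - 1) * |x1 * y1| + Real.sqrt (1 - x1 ^ 2) * Real.sqrt (1 - y1 ^ 2)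
      ≤ 2 - 2 / lam ^ 2 := by
  have hpos : 0 < lam := lt_of_lt_of_le (by positivity) hlam
  have hlam2 : 2 ≤ lam ^ 2 := (Real.sqrt_le_left hpos.le).mp hlam
  have hinv : (1 / lam) ^ 2 ≤ 1 := by
    rw [div_pow, one_pow, div_le_one (by positivity)]
    linarith
  have hx2 : x1 ^ 2 ≤ (1 / lam) ^ 2 := by
    rw [← sq_abs x1]
    gcongr
  have hy2 : y1 ^ 2 ≤ (1 / lam) ^ 2 := by
    rw [← sq_abs y1]
    gcongr
  have hxy : |x1 * y1| ≤ (1 / lam) ^ 2 := by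
    rw [abs_mul, sq]
    gcongr
  have hsqrt : Real.sqrt (1 - x1 ^ 2) * Real.sqrt (1 - y1 ^ 2) ≤ 1 - |x1 * y1| := by
    have hsx : Real.sqrt (1 - x1 ^ 2) ^ 2 = 1 - x1 ^ 2 := Real.sq_sqrt (by linarith)
    have hsy : Real.sqrt (1 - y1 ^ 2) ^ 2 = 1 - y1 ^ 2 := Real.sq_sqrt (by linarith)
    rw [abs_mul]
    linarith [two_mul_le_add_sq (Real.sqrt (1 - x1 ^ 2)) (Real.sqrt (1 - y1 ^ 2)),
      two_mul_le_add_sq |x1| |y1|, sq_abs x1, sq_abs y1]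
  calc (lam ^ 2 - 1) * |x1 * y1| + Real.sqrt (1 - x1 ^ 2) * Real.sqrt (1 - y1 ^ 2)
      ≤ (lam ^ 2 - 2) * |x1 * y1| + 1 := by linarith
    _ ≤ (lam ^ 2 - 2) * (1 / lam) ^ 2 + 1 := by
      gcongr
    _ = 2 - 2 / lam ^ 2 := by
      field_simp
      ring
end

section
/- Let λ ≥ 1, let ξ, η > 0, and let ‖·‖ denote the norm of the Banaś–Frączek space R_λ². Set x = (1/λ, √(1 − 1/λ²)) and y = (1/λ, −√(1 − 1/λ²)). Then ‖x‖ = 1, ‖y‖ = 1, and (‖ξx + ηy‖² + ‖ηx − ξy‖²) / (2(ξ² + η²)) = 1 + (2ξη/(ξ² + η²))·(1 − 1/λ²). -/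
/-- The norm of the Banaś–Frączek space `R_λ²`:  `‖(a,b)‖ = max {λ|a|, √(a²+b²)}`. -/
noncomputable def BFnorm (lam : ℝ) (p : ℝ × ℝ) : ℝ :=
  max (lam * |p.1|) (Real.sqrt (p.1 ^ 2 + p.2 ^ 2))

theorem BFnorm_nonneg (lam : ℝ) (p : ℝ × ℝ) : 0 ≤ BFnorm lam p :=
  le_max_of_le_right (Real.sqrt_nonneg _)

theorem BFnorm_sq {lam : ℝ} (hlam : 0 ≤ lam) (p : ℝ × ℝ) :
    BFnorm lam p ^ 2 = max ((lam * p.1) ^ 2) (p.1 ^ 2 + p.2 ^ 2) := by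
  have hE : Real.sqrt (p.1 ^ 2 + p.2 ^ 2) ^ 2 = p.1 ^ 2 + p.2 ^ 2 :=
    Real.sq_sqrt (by positivity)
  have hA : (lam * |p.1|) ^ 2 = (lam * p.1) ^ 2 := by rw [mul_pow, sq_abs, mul_pow]
  rw [← hE, ← hA, BFnorm]
  exact (pow_left_monotoneOn (n := 2)).map_max (a := lam * |p.1|)
    (mul_nonneg hlam (abs_nonneg _)) (Real.sqrt_nonneg _)

theorem BFnorm_eq_one {lam : ℝ} (hlam : 0 < lam) {p : ℝ × ℝ} (h₁ : lam * p.1 = 1)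
    (h : p.1 ^ 2 + p.2 ^ 2 = 1) : BFnorm lam p = 1 := by
  have hsq : BFnorm lam p ^ 2 = 1 := by rw [BFnorm_sq hlam.le, h₁, h]; norm_num
  exact (pow_eq_one_iff_of_nonneg (BFnorm_nonneg _ _) two_ne_zero).1 hsq

theorem stmt5 (lam ξ η : ℝ) (hlam : 1 ≤ lam) (hξ : 0 < ξ) (hη : 0 < η)
    (x y : ℝ × ℝ)
    (hx : x = (1 / lam, Real.sqrt (1 - 1 / lam ^ 2)))
    (hy : y = (1 / lam, -Real.sqrt (1 - 1 / lam ^ 2))) :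
    BFnorm lam x = 1 ∧ BFnorm lam y = 1 ∧
      (BFnorm lam (ξ • x + η • y) ^ 2 + BFnorm lam (η • x - ξ • y) ^ 2) /
          (2 * (ξ ^ 2 + η ^ 2))
        = 1 + (2 * ξ * η / (ξ ^ 2 + η ^ 2)) * (1 - 1 / lam ^ 2) := by
  have hpos : 0 < lam := by linarith
  have hc₁ : 1 / lam ^ 2 ≤ 1 := by
    rw [div_le_one (by positivity)]
    nlinarith
  have hs : Real.sqrt (1 - 1 / lam ^ 2) ^ 2 = 1 - (1 / lam) ^ 2 := by
    rw [Real.sq_sqrt (by linarith), one_div_pow]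
  rw [← one_div_pow] at hc₁
  set s := Real.sqrt (1 - 1 / lam ^ 2)
  rw [← one_div_pow]
  set t := 1 / lam
  have hlt : lam * t = 1 := mul_one_div_cancel hpos.ne'
  subst hx hy
  refine ⟨BFnorm_eq_one hpos hlt (by linear_combination hs),
    BFnorm_eq_one hpos hlt (by linear_combination hs), ?_⟩
  have hadd : BFnorm lam (ξ • (t, s) + η • (t, -s)) ^ 2 = (ξ + η) ^ 2 := by
    have hA : (lam * (ξ * t + η * t)) ^ 2 = (ξ + η) ^ 2 := by
      rw [show lam * (ξ * t + η * t) = (ξ + η) * (lam * t) by ring, hlt, mul_one]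
    have hE : (ξ * t + η * t) ^ 2 + (ξ * s + η * -s) ^ 2
        = (ξ + η) ^ 2 - 4 * (ξ * η) * (1 - t ^ 2) := by
      linear_combination (ξ - η) ^ 2 * hs
    rw [BFnorm_sq hpos.le]
    simp only [Prod.fst_add, Prod.snd_add, Prod.smul_fst, Prod.smul_snd, smul_eq_mul]
    rw [hA, hE, max_eq_left]
    have := mul_nonneg (mul_pos hξ hη).le (sub_nonneg.2 hc₁)
    linarith
  have hsub : BFnorm lam (η • (t, s) - ξ • (t, -s)) ^ 2
      = (η - ξ) ^ 2 + 4 * (ξ * η) * (1 - t ^ 2) := by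
    have hA : (lam * (η * t - ξ * t)) ^ 2 = (η - ξ) ^ 2 := by
      rw [show lam * (η * t - ξ * t) = (η - ξ) * (lam * t) by ring, hlt, mul_one]
    have hE : (η * t - ξ * t) ^ 2 + (η * s - ξ * -s) ^ 2
        = (η - ξ) ^ 2 + 4 * (ξ * η) * (1 - t ^ 2) := by
      linear_combination (ξ + η) ^ 2 * hs
    rw [BFnorm_sq hpos.le]
    simp only [Prod.fst_sub, Prod.snd_sub, Prod.smul_fst, Prod.smul_snd, smul_eq_mul]
    rw [hA, hE, max_eq_right]
    have := mul_nonneg (mul_pos hξ hη).le (sub_nonneg.2 hc₁)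
    linarith
  rw [hadd, hsub]
  have : ξ ^ 2 + η ^ 2 ≠ 0 := by positivity
  field_simp
  ring
end
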